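/- Let d₁ < d₂ be positive integers and c₁, c₂ > 0 real constants. Let m, n : ℕ → ℕ be sequences of positive integers with m(N) = c₁ N^{d₁} + O(N^{d₁−1}) and n(N) = c₂ N^{d₂} + O(N^{d₂−1}) as N → ∞. Then the average entanglement entropy ⟨E_N⟩ = ∫_{S} E(v) dμ_N(v), where μ_N is the uniform probability measure on the unit sphere of ℂ^{m(N)} ⊗ ℂ^{n(N)}, satisfies ⟨E_N⟩ = d₁·ln N + ln c₁ + O(1/N) as N → ∞. -/

import Mathlib

open MeasureTheory Matrix

noncomputable section

instance (ι : Type*) [Fintype ι] : MeasurableSpace (EuclideanSpace ℂ ι) := borel _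
instance (ι : Type*) [Fintype ι] : BorelSpace (EuclideanSpace ℂ ι) := ⟨rfl⟩
instance (ι : Type*) [Fintype ι] : InnerProductSpace ℝ (EuclideanSpace ℂ ι) :=
  InnerProductSpace.rclikeToReal ℂ _

/-- The model for `ℂ^m ⊗ ℂ^n`: a Euclidean space indexed by `Fin m × Fin n`,
so that a vector is identified with the matrix of its coefficients in the
fixed (standard) orthonormal bases. -/
abbrev TensorSp (m n : ℕ) := EuclideanSpace ℂ (Fin m × Fin n)

/-- The coefficient matrix `A(v)` of `v ∈ ℂ^m ⊗ ℂ^n`. -/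
def coeffMatrix {m n : ℕ} (v : TensorSp m n) : Matrix (Fin m) (Fin n) ℂ :=
  Matrix.of fun j k => v (j, k)

/-- The reduced density matrix `ρ(v) = A(v) A(v)*`. -/
def redDensity {m n : ℕ} (v : TensorSp m n) : Matrix (Fin m) (Fin m) ℂ :=
  coeffMatrix v * (coeffMatrix v)ᴴ

theorem redDensity_isHermitian {m n : ℕ} (v : TensorSp m n) :
    (redDensity v).IsHermitian :=
  Matrix.isHermitian_mul_conjTranspose_self _

/-- The eigenvalues `p_1(v), …, p_m(v)` of the reduced density matrix
(the squares of the Schmidt coefficients of `v`). -/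
def schmidtSq {m n : ℕ} (v : TensorSp m n) : Fin m → ℝ :=
  (redDensity_isHermitian v).eigenvalues

/-- The entanglement entropy `E(v) = -∑ p_j ln p_j` (recall `Real.log 0 = 0`,
which implements the convention `0 · ln 0 = 0`). -/
def entEntropy {m n : ℕ} (v : TensorSp m n) : ℝ :=
  -∑ j, schmidtSq v j * Real.log (schmidtSq v j)

/-- The uniform (rotation-invariant) probability measure on the unit sphere
`S^{2mn-1}` of `ℂ^m ⊗ ℂ^n`: the normalization of the measure induced on the
sphere by the Lebesgue (Haar) measure of the ambient Euclidean space. -/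
def sphereUniform (m n : ℕ) : Measure (Metric.sphere (0 : TensorSp m n) 1) :=
  ((volume : Measure (TensorSp m n)).toSphere Set.univ)⁻¹ •
    (volume : Measure (TensorSp m n)).toSphere

open Asymptotics Filter

open Polynomial in
theorem Matrix.IsHermitian.trace_aeval {m : ℕ} {A : Matrix (Fin m) (Fin m) ℂ}
    (hA : A.IsHermitian) (p : ℝ[X]) :
    (aeval A p).trace = ∑ i, ((p.eval (hA.eigenvalues i) : ℝ) : ℂ) := by
  have hA' : IsSelfAdjoint A := hA
  rw [← cfc_polynomial p A hA', hA.cfc_eq, IsHermitian.cfc, Unitary.conjStarAlgAut_apply,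
    trace_mul_cycle]
  simp [trace_diagonal]

theorem continuous_redDensity (m n : ℕ) :
    Continuous (redDensity : TensorSp m n → Matrix (Fin m) (Fin m) ℂ) := by
  have h : Continuous (coeffMatrix : TensorSp m n → Matrix (Fin m) (Fin n) ℂ) := by
    refine continuous_matrix fun i j => ?_
    simp only [coeffMatrix, of_apply]
    fun_prop
  exact h.matrix_mul h.matrix_conjTranspose

theorem schmidtSq_nonneg {m n : ℕ} (v : TensorSp m n) (j : Fin m) : 0 ≤ schmidtSq v j :=
  open scoped ComplexOrder in
  (Matrix.posSemidef_self_mul_conjTranspose (coeffMatrix v)).eigenvalues_nonneg j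

theorem sum_schmidtSq {m n : ℕ} (v : TensorSp m n) : ∑ j, schmidtSq v j = ‖v‖ ^ 2 := by
  have h := (redDensity_isHermitian v).trace_eq_sum_eigenvalues
  rw [EuclideanSpace.norm_sq_eq, Fintype.sum_prod_type]
  have h2 : (redDensity v).trace = ((∑ i, ∑ j, ‖v (i, j)‖ ^ 2 : ℝ) : ℂ) := by
    simp [Matrix.trace, redDensity, coeffMatrix, Matrix.mul_apply, Complex.mul_conj']
  rw [h2] at h
  refine Complex.ofReal_injective ?_
  rw [h, Complex.ofReal_sum]
  rfl

theorem sum_schmidtSq_sq {m n : ℕ} (v : TensorSp m n) :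
    ∑ j, schmidtSq v j ^ 2 = (redDensity v * redDensity v).trace.re := by
  have h := (redDensity_isHermitian v).trace_aeval (Polynomial.X ^ 2)
  simp only [map_pow, Polynomial.aeval_X, Polynomial.eval_pow, Polynomial.eval_X] at h
  rw [← pow_two, h, ← Complex.ofReal_sum, Complex.ofReal_re]
  rfl

theorem schmidtSq_le_one {m n : ℕ} {v : TensorSp m n} (hv : ‖v‖ = 1) (j : Fin m) :
    schmidtSq v j ≤ 1 := by
  have h := Finset.single_le_sum (f := schmidtSq v) (fun i _ => schmidtSq_nonneg v i)
    (Finset.mem_univ j)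
  rw [sum_schmidtSq, hv] at h
  simpa using h

theorem entEntropy_nonneg {m n : ℕ} {v : TensorSp m n} (hv : ‖v‖ = 1) : 0 ≤ entEntropy v := by
  rw [entEntropy, ← Finset.sum_neg_distrib]
  refine Finset.sum_nonneg fun j _ => ?_
  have := Real.log_nonpos (schmidtSq_nonneg v j) (schmidtSq_le_one hv j)
  nlinarith [schmidtSq_nonneg v j]

theorem log_sub_entEntropy {m n : ℕ} {v : TensorSp m n} (hv : ‖v‖ = 1) :
    Real.log m - entEntropy v = ∑ j, schmidtSq v j * (Real.log m + Real.log (schmidtSq v j)) := by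
  simp only [entEntropy, mul_add, Finset.sum_add_distrib, ← Finset.sum_mul, sum_schmidtSq, hv]
  ring

theorem entEntropy_le_log {m n : ℕ} (hm : 0 < m) {v : TensorSp m n} (hv : ‖v‖ = 1) :
    entEntropy v ≤ Real.log m := by
  have hm' : (0 : ℝ) < m := by exact_mod_cast hm
  have h : ∑ j, (schmidtSq v j - 1 / m) ≤ Real.log m - entEntropy v := by
    rw [log_sub_entEntropy hv]
    refine Finset.sum_le_sum fun j _ => ?_
    rcases (schmidtSq_nonneg v j).eq_or_lt with h0 | h0
    · rw [← h0]; simp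
    · have h1 := Real.one_sub_inv_le_log_of_pos (mul_pos hm' h0)
      rw [Real.log_mul hm'.ne' h0.ne'] at h1
      calc _ = schmidtSq v j * (1 - (m * schmidtSq v j)⁻¹) := by field_simp
        _ ≤ _ := by gcongr
  rw [Finset.sum_sub_distrib, sum_schmidtSq, hv] at h
  simp only [one_pow, Finset.sum_const, Finset.card_univ, Fintype.card_fin, nsmul_eq_mul] at h
  rw [mul_one_div_cancel hm'.ne'] at h
  linarith

/-- The entropy is bounded below by the linear entropy. -/
theorem log_sub_entEntropy_le {m n : ℕ} (hm : 0 < m) {v : TensorSp m n} (hv : ‖v‖ = 1) :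
    Real.log m - entEntropy v ≤ m * (redDensity v * redDensity v).trace.re - 1 := by
  have hm' : (0 : ℝ) < m := by exact_mod_cast hm
  calc Real.log m - entEntropy v ≤ ∑ j, (m * schmidtSq v j ^ 2 - schmidtSq v j) := by
        rw [log_sub_entEntropy hv]
        refine Finset.sum_le_sum fun j _ => ?_
        rcases (schmidtSq_nonneg v j).eq_or_lt with h0 | h0
        · rw [← h0]; simp
        · have h1 := Real.log_le_sub_one_of_pos (mul_pos hm' h0)
          rw [Real.log_mul hm'.ne' h0.ne'] at h1
          nlinarith
    _ = _ := by
        rw [Finset.sum_sub_distrib, ← Finset.mul_sum, sum_schmidtSq_sq, sum_schmidtSq, hv, one_pow]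

open Polynomial in
theorem measurable_entEntropy_sphere (m n : ℕ) :
    Measurable fun v : Metric.sphere (0 : TensorSp m n) 1 => entEntropy (v : TensorSp m n) := by
  have key : ∀ k : ℕ, ∃ p : ℝ[X], ∀ x ∈ Set.Icc (0 : ℝ) 1,
      |p.eval x - Real.negMulLog x| < 1 / ((k : ℝ) + 1) := fun k =>
    exists_polynomial_near_of_continuousOn 0 1 _ Real.continuous_negMulLog.continuousOn _
      (by positivity)
  choose p hp using key
  refine measurable_of_tendsto_metrizable (f := fun (k : ℕ) (v : Metric.sphere (0 : TensorSp m n) 1) =>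
    ((aeval (redDensity (v : TensorSp m n)) (p k)).trace).re) (fun k => ?_) ?_
  · refine Continuous.measurable ?_
    have h : Continuous fun v : Metric.sphere (0 : TensorSp m n) 1 =>
        redDensity (v : TensorSp m n) := (continuous_redDensity m n).comp continuous_subtype_val
    simp only [aeval_eq_sum_range]
    exact Complex.continuous_re.comp (Continuous.matrix_trace
      (continuous_finsetSum _ fun i _ => by fun_prop))
  · rw [tendsto_pi_nhds]
    intro v
    have hv : ‖(v : TensorSp m n)‖ = 1 := by simp
    have e : entEntropy (v : TensorSp m n) =
        ∑ j, Real.negMulLog (schmidtSq (v : TensorSp m n) j) := by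
      simp [entEntropy, Real.negMulLog]
    rw [e]
    simp only [(redDensity_isHermitian _).trace_aeval, ← Complex.ofReal_sum, Complex.ofReal_re]
    refine tendsto_finsetSum _ fun j _ => ?_
    rw [tendsto_iff_dist_tendsto_zero]
    refine squeeze_zero (fun _ => dist_nonneg) (fun k => ?_) tendsto_one_div_add_atTop_nhds_zero_nat
    rw [Real.dist_eq]
    exact (hp k _ ⟨schmidtSq_nonneg _ j, schmidtSq_le_one hv j⟩).le

section SphereInvariance

variable {E : Type*} [NormedAddCommGroup E] [NormedSpace ℝ E] [MeasurableSpace E] [BorelSpace E]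

/-- A linear isometry, restricted to the unit sphere. -/
def sphereMap (f : E ≃ₗᵢ[ℝ] E) (v : Metric.sphere (0 : E) 1) : Metric.sphere (0 : E) 1 :=
  ⟨f v, by simp⟩

open scoped Pointwise in
theorem measurePreserving_sphereMap {μ : Measure E} (f : E ≃ₗᵢ[ℝ] E)
    (hf : MeasurePreserving f μ μ) : MeasurePreserving (sphereMap f) μ.toSphere μ.toSphere := by
  have hc : Continuous (sphereMap f) :=
    (f.continuous.comp continuous_subtype_val).subtype_mk _
  refine ⟨hc.measurable, ?_⟩
  ext s hs
  rw [Measure.map_apply hc.measurable hs, Measure.toSphere_apply' _ hs,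
    Measure.toSphere_apply' _ (hc.measurable hs)]
  congr 1
  have he : MeasurableEmbedding f := f.toHomeomorph.measurableEmbedding
  rw [← hf.measure_preimage_emb he (Set.Ioo (0 : ℝ) 1 • (Subtype.val '' s))]
  congr 1
  ext x
  simp only [Set.mem_smul, Set.mem_image, Set.mem_preimage, Subtype.exists, exists_and_right,
    exists_eq_right]
  constructor
  · rintro ⟨r, hr, y, ⟨hy, hys⟩, rfl⟩
    exact ⟨r, hr, f y, ⟨by simpa using hy, hys⟩, by simp⟩
  · rintro ⟨r, hr, y, ⟨hy, hys⟩, h⟩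
    refine ⟨r, hr, f.symm y, ⟨by simpa using hy, ?_⟩, ?_⟩
    · simpa [sphereMap] using hys
    · apply f.injective
      simpa using h

end SphereInvariance

theorem isProbabilityMeasure_sphereUniform {m n : ℕ} (hm : 0 < m) (hn : 0 < n) :
    IsProbabilityMeasure (sphereUniform m n) := by
  have : Nonempty (Fin m × Fin n) := ⟨(⟨0, hm⟩, ⟨0, hn⟩)⟩
  have : Nontrivial (TensorSp m n) := inferInstance
  constructor
  rw [sphereUniform, Measure.smul_apply, smul_eq_mul]
  exact ENNReal.inv_mul_cancel (Measure.measure_univ_ne_zero.2 (Measure.toSphere_ne_zero _))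
    (measure_ne_top _ _)

theorem integral_sphereUniform_comp {m n : ℕ} (f : TensorSp m n ≃ₗᵢ[ℝ] TensorSp m n)
    {F : TensorSp m n → ℝ} (hF : Continuous F) :
    ∫ v, F (f (v : TensorSp m n)) ∂(sphereUniform m n) =
      ∫ v, F (v : TensorSp m n) ∂(sphereUniform m n) := by
  have h := measurePreserving_sphereMap f f.measurePreserving
  rw [sphereUniform, integral_smul_measure, integral_smul_measure]
  congr 1
  have h2 := integral_map (μ := (volume : Measure (TensorSp m n)).toSphere)
    h.measurable.aemeasurable
    (f := fun v : Metric.sphere (0 : TensorSp m n) 1 => F (v : TensorSp m n))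
    (hF.comp continuous_subtype_val).aestronglyMeasurable
  rw [h.map_eq] at h2
  exact h2.symm

theorem integrable_sphereUniform {m n : ℕ} (hm : 0 < m) (hn : 0 < n)
    {F : TensorSp m n → ℝ} (hF : Continuous F) :
    Integrable (fun v : Metric.sphere (0 : TensorSp m n) 1 => F (v : TensorSp m n))
      (sphereUniform m n) := by
  have := isProbabilityMeasure_sphereUniform hm hn
  exact (hF.comp continuous_subtype_val).integrable_of_hasCompactSupport
    (HasCompactSupport.of_compactSpace _)

section Moments

variable {m n : ℕ}

/-- Permutation of coordinates. -/
def swapIsometry (a b : Fin m × Fin n) : TensorSp m n ≃ₗᵢ[ℝ] TensorSp m n :=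
  LinearIsometryEquiv.piLpCongrLeft 2 ℝ ℂ (Equiv.swap a b)

theorem swapIsometry_apply (a b i : Fin m × Fin n) (v : TensorSp m n) :
    swapIsometry a b v i = v (Equiv.swap a b i) := by
  simp [swapIsometry, Equiv.piCongrLeft'_apply]

/-- Change of sign of one coordinate. -/
def flipIsometry (a : Fin m × Fin n) : TensorSp m n ≃ₗᵢ[ℝ] TensorSp m n :=
  LinearIsometryEquiv.piLpCongrRight 2
    fun i => if i = a then LinearIsometryEquiv.neg ℝ else LinearIsometryEquiv.refl ℝ ℂ

theorem flipIsometry_apply (a i : Fin m × Fin n) (v : TensorSp m n) :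
    flipIsometry a v i = if i = a then -v i else v i := by
  simp only [flipIsometry, LinearIsometryEquiv.piLpCongrRight_apply]
  split_ifs <;> simp

theorem norm_hadamard_sq (x y : ℂ) :
    ‖((√2)⁻¹ : ℝ) • (x + y)‖ ^ 2 + ‖((√2)⁻¹ : ℝ) • (x - y)‖ ^ 2 = ‖x‖ ^ 2 + ‖y‖ ^ 2 := by
  have h := parallelogram_law_with_norm ℝ x y
  have h2 : (√2)⁻¹ ^ 2 = (1 / 2 : ℝ) := by rw [inv_pow, Real.sq_sqrt (by norm_num)]; norm_num
  simp only [norm_smul, mul_pow, Real.norm_eq_abs, sq_abs, h2]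
  nlinarith

/-- The rotation by `π / 4`, composed with a reflection, in the plane of two coordinates. -/
def hadamardLinear (a b : Fin m × Fin n) : TensorSp m n →ₗ[ℝ] TensorSp m n where
  toFun v := WithLp.toLp 2 fun i => if i = a then ((√2)⁻¹ : ℝ) • (v a + v b)
    else if i = b then ((√2)⁻¹ : ℝ) • (v a - v b) else v i
  map_add' v w := by
    ext i
    simp only [PiLp.add_apply]
    split_ifs <;> module
  map_smul' c v := by
    ext i
    simp only [PiLp.smul_apply, RingHom.id_apply]
    split_ifs <;> module

theorem norm_hadamardLinear {a b : Fin m × Fin n} (hab : a ≠ b) (v : TensorSp m n) :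
    ‖hadamardLinear a b v‖ = ‖v‖ := by
  rw [← sq_eq_sq₀ (norm_nonneg _) (norm_nonneg _), EuclideanSpace.norm_sq_eq,
    EuclideanSpace.norm_sq_eq]
  have hb : b ∈ Finset.univ.erase a := by simp [hab.symm]
  rw [← Finset.add_sum_erase _ _ (Finset.mem_univ a), ← Finset.add_sum_erase _ _ hb,
    ← Finset.add_sum_erase _ (fun i => ‖v i‖ ^ 2) (Finset.mem_univ a),
    ← Finset.add_sum_erase _ (fun i => ‖v i‖ ^ 2) hb, ← add_assoc, ← add_assoc]
  congr 1
  · simpa [hadamardLinear, hab.symm] using norm_hadamard_sq (v a) (v b)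
  · refine Finset.sum_congr rfl fun i hi => ?_
    simp only [Finset.mem_erase, Finset.mem_univ, and_true] at hi
    simp [hadamardLinear, hi.1, hi.2]

/-- The rotation by `π / 4`, composed with a reflection, as an isometry. -/
def hadamardIsometry {a b : Fin m × Fin n} (hab : a ≠ b) : TensorSp m n ≃ₗᵢ[ℝ] TensorSp m n :=
  LinearIsometry.toLinearIsometryEquiv ⟨hadamardLinear a b, norm_hadamardLinear hab⟩ rfl

theorem hadamardIsometry_apply_left {a b : Fin m × Fin n} (hab : a ≠ b) (v : TensorSp m n) :
    hadamardIsometry hab v a = ((√2)⁻¹ : ℝ) • (v a + v b) := by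
  simp [hadamardIsometry, hadamardLinear]

theorem hadamardIsometry_apply_right {a b : Fin m × Fin n} (hab : a ≠ b) (v : TensorSp m n) :
    hadamardIsometry hab v b = ((√2)⁻¹ : ℝ) • (v a - v b) := by
  simp [hadamardIsometry, hadamardLinear, hab.symm]

/-- The average over the unit sphere. -/
def sphereAvg (F : TensorSp m n → ℝ) : ℝ := ∫ v, F (v : TensorSp m n) ∂(sphereUniform m n)

theorem sphereAvg_comp (f : TensorSp m n ≃ₗᵢ[ℝ] TensorSp m n) {F : TensorSp m n → ℝ}
    (hF : Continuous F) : sphereAvg (fun v => F (f v)) = sphereAvg F :=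
  integral_sphereUniform_comp f hF

theorem sphereAvg_mono (hm : 0 < m) (hn : 0 < n) {F G : TensorSp m n → ℝ} (hF : Continuous F)
    (hG : Continuous G) (h : ∀ v, ‖v‖ = 1 → F v ≤ G v) : sphereAvg F ≤ sphereAvg G :=
  integral_mono (integrable_sphereUniform hm hn hF) (integrable_sphereUniform hm hn hG)
    fun v => h v (by simp)

theorem sphereAvg_congr {F G : TensorSp m n → ℝ} (h : ∀ v, ‖v‖ = 1 → F v = G v) :
    sphereAvg F = sphereAvg G :=
  integral_congr_ae (Eventually.of_forall fun v => h v (by simp))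

theorem sphereAvg_add (hm : 0 < m) (hn : 0 < n) {F G : TensorSp m n → ℝ} (hF : Continuous F)
    (hG : Continuous G) : sphereAvg (fun v => F v + G v) = sphereAvg F + sphereAvg G :=
  integral_add (integrable_sphereUniform hm hn hF) (integrable_sphereUniform hm hn hG)

theorem sphereAvg_sum (hm : 0 < m) (hn : 0 < n) {κ : Type*} (s : Finset κ)
    {F : κ → TensorSp m n → ℝ} (hF : ∀ i, Continuous (F i)) :
    sphereAvg (fun v => ∑ i ∈ s, F i v) = ∑ i ∈ s, sphereAvg (F i) :=
  integral_finsetSum s fun i _ => integrable_sphereUniform hm hn (hF i)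

theorem sphereAvg_const_mul (c : ℝ) (F : TensorSp m n → ℝ) :
    sphereAvg (fun v => c * F v) = c * sphereAvg F :=
  integral_const_mul c _

theorem sphereAvg_const (hm : 0 < m) (hn : 0 < n) (c : ℝ) :
    sphereAvg (fun _ : TensorSp m n => c) = c := by
  have := isProbabilityMeasure_sphereUniform hm hn
  simp [sphereAvg]

theorem sphereAvg_sq_norm (hm : 0 < m) (hn : 0 < n) (a : Fin m × Fin n) :
    sphereAvg (fun v : TensorSp m n => ‖v a‖ ^ 2) = 1 / (m * n) := by
  have h1 : ∀ b, sphereAvg (fun v : TensorSp m n => ‖v b‖ ^ 2) =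
      sphereAvg (fun v : TensorSp m n => ‖v a‖ ^ 2) := fun b => by
    rw [← sphereAvg_comp (swapIsometry a b) (by fun_prop)]
    simp [swapIsometry_apply]
  have h2 := sphereAvg_sum hm hn Finset.univ
    (F := fun (b : Fin m × Fin n) (v : TensorSp m n) => ‖v b‖ ^ 2) (fun b => by fun_prop)
  rw [Finset.sum_congr rfl fun b _ => h1 b, sphereAvg_congr (G := fun _ => 1) fun v hv => by
    rw [← EuclideanSpace.norm_sq_eq, hv, one_pow], sphereAvg_const hm hn] at h2
  simp only [Finset.sum_const, Finset.card_univ, Fintype.card_prod, Fintype.card_fin,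
    nsmul_eq_mul, Nat.cast_mul] at h2
  have hm' : (0 : ℝ) < m := by exact_mod_cast hm
  have hn' : (0 : ℝ) < n := by exact_mod_cast hn
  field_simp
  linarith

theorem le_sphereAvg_norm_pow_four (hm : 0 < m) (hn : 0 < n) (a : Fin m × Fin n) :
    1 / (m * n : ℝ) ^ 2 ≤ sphereAvg (fun v : TensorSp m n => ‖v a‖ ^ 4) := by
  have h := sphereAvg_mono hm hn
    (F := fun v : TensorSp m n => 2 / (m * n : ℝ) * ‖v a‖ ^ 2 + (-(1 / (m * n : ℝ) ^ 2)))
    (G := fun v => ‖v a‖ ^ 4) (by fun_prop) (by fun_prop) fun v _ => by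
      have := sq_nonneg (‖v a‖ ^ 2 - 1 / (m * n : ℝ))
      ring_nf at this ⊢
      linarith
  rw [sphereAvg_add hm hn (by fun_prop) (by fun_prop), sphereAvg_const hm hn,
    sphereAvg_const_mul, sphereAvg_sq_norm hm hn] at h
  refine le_trans (le_of_eq ?_) h
  ring

theorem sphereAvg_sq_mul_sq_le (hm : 0 < m) (hn : 0 < n) {a b : Fin m × Fin n} (hab : a ≠ b) :
    sphereAvg (fun v : TensorSp m n => ‖v a‖ ^ 2 * ‖v b‖ ^ 2) ≤ 1 / (m * n : ℝ) ^ 2 := by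
  have h1 : ∀ c ∈ Finset.univ.erase a, sphereAvg (fun v : TensorSp m n => ‖v a‖ ^ 2 * ‖v c‖ ^ 2) =
      sphereAvg (fun v : TensorSp m n => ‖v a‖ ^ 2 * ‖v b‖ ^ 2) := fun c hc => by
    rw [← sphereAvg_comp (swapIsometry b c) (by fun_prop)]
    simp only [swapIsometry_apply, Equiv.swap_apply_right]
    rw [Equiv.swap_apply_of_ne_of_ne hab (Finset.ne_of_mem_erase hc).symm]
  have h2 := sphereAvg_sum hm hn Finset.univ
    (F := fun (c : Fin m × Fin n) (v : TensorSp m n) => ‖v a‖ ^ 2 * ‖v c‖ ^ 2)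
    (fun b => by fun_prop)
  rw [← Finset.add_sum_erase _ _ (Finset.mem_univ a), Finset.sum_congr rfl h1,
    sphereAvg_congr (G := fun v => ‖v a‖ ^ 2) fun v hv => by
      rw [← Finset.mul_sum, ← EuclideanSpace.norm_sq_eq, hv, one_pow, mul_one],
    sphereAvg_sq_norm hm hn] at h2
  have h4 := le_sphereAvg_norm_pow_four hm hn a
  have hD : (2 : ℝ) ≤ m * n := by
    have : Nontrivial (Fin m × Fin n) := ⟨a, b, hab⟩
    have := Fintype.one_lt_card (α := Fin m × Fin n)
    simp only [Fintype.card_prod, Fintype.card_fin] at this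
    exact_mod_cast this
  have hcard : ((Finset.univ.erase a).card : ℝ) = m * n - 1 := by
    rw [Finset.card_erase_of_mem (Finset.mem_univ a), Nat.cast_sub (Finset.card_pos.2 ⟨a, by simp⟩)]
    simp
  have h5 : sphereAvg (fun v : TensorSp m n => ‖v a‖ ^ 2 * ‖v a‖ ^ 2) =
      sphereAvg (fun v : TensorSp m n => ‖v a‖ ^ 4) := by
    congr 1; ext v; ring
  simp only [Finset.sum_const, nsmul_eq_mul, hcard] at h2
  rw [h5] at h2
  generalize sphereAvg (fun v : TensorSp m n => ‖v a‖ ^ 2 * ‖v b‖ ^ 2) = x at *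
  generalize (m * n : ℝ) = D at *
  have h6 : (D - 1) * x ≤ (D - 1) * (1 / D ^ 2) := by
    have : (D - 1) * (1 / D ^ 2) = 1 / D - 1 / D ^ 2 := by field_simp
    linarith
  exact le_of_mul_le_mul_left h6 (by linarith)

theorem norm_hadamard_pow_four (x y : ℂ) :
    ‖((√2)⁻¹ : ℝ) • (x + y)‖ ^ 4 + ‖((√2)⁻¹ : ℝ) • (x - y)‖ ^ 4 ≤
      (‖x‖ ^ 4 + ‖y‖ ^ 4) / 2 + 3 * (‖x‖ ^ 2 * ‖y‖ ^ 2) := by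
  have h2 : (√2)⁻¹ ^ 2 = (1 / 2 : ℝ) := by rw [inv_pow, Real.sq_sqrt (by norm_num)]; norm_num
  have h4 : (√2)⁻¹ ^ 4 = (1 / 4 : ℝ) := by
    rw [show (√2)⁻¹ ^ 4 = ((√2)⁻¹ ^ 2) ^ 2 by ring, h2]; norm_num
  have e : ∀ z : ℂ, ‖z‖ ^ 4 = (‖z‖ ^ 2) ^ 2 := fun z => by ring
  simp only [norm_smul, mul_pow, Real.norm_eq_abs]
  rw [show |(√2)⁻¹| = (√2)⁻¹ from abs_of_nonneg (by positivity), h4]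
  simp only [e, Complex.sq_norm, Complex.normSq_apply, Complex.add_re, Complex.add_im,
    Complex.sub_re, Complex.sub_im]
  nlinarith [sq_nonneg (x.re * y.im - x.im * y.re)]

theorem sphereAvg_norm_pow_four_le (hm : 0 < m) (hn : 0 < n) {a b : Fin m × Fin n} (hab : a ≠ b) :
    sphereAvg (fun v : TensorSp m n => ‖v a‖ ^ 4) ≤ 3 / (m * n : ℝ) ^ 2 := by
  have hba : sphereAvg (fun v : TensorSp m n => ‖v b‖ ^ 4) =
      sphereAvg (fun v : TensorSp m n => ‖v a‖ ^ 4) := by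
    rw [← sphereAvg_comp (swapIsometry a b) (by fun_prop)]
    simp [swapIsometry_apply]
  have h := sphereAvg_comp (hadamardIsometry hab)
    (F := fun v : TensorSp m n => ‖v a‖ ^ 4 + ‖v b‖ ^ 4) (by fun_prop)
  simp only [hadamardIsometry_apply_left, hadamardIsometry_apply_right] at h
  have h2 := sphereAvg_mono hm hn (by fun_prop) (by fun_prop)
    fun v _ => norm_hadamard_pow_four (v a) (v b)
  rw [h, sphereAvg_add hm hn (by fun_prop) (by fun_prop),
    sphereAvg_add hm hn (by fun_prop) (by fun_prop), sphereAvg_const_mul] at h2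
  simp only [div_eq_inv_mul] at h2
  rw [sphereAvg_const_mul, sphereAvg_add hm hn (by fun_prop) (by fun_prop), hba] at h2
  have h3 := sphereAvg_sq_mul_sq_le hm hn hab
  rw [show 3 / (m * n : ℝ) ^ 2 = 3 * (1 / (m * n : ℝ) ^ 2) by ring]
  linarith

end Moments

section Purity

variable {m n : ℕ}

/-- A quartic monomial occurring in the purity `tr ρ(v)²`. -/
def purityTerm (v : TensorSp m n) (j k : Fin m) (l l' : Fin n) : ℝ :=
  (v (j, l) * star (v (k, l)) * (v (k, l') * star (v (j, l')))).re

theorem continuous_purityTerm (j k : Fin m) (l l' : Fin n) :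
    Continuous fun v : TensorSp m n => purityTerm v j k l l' := by
  unfold purityTerm
  fun_prop

theorem trace_redDensity_mul_self_re (v : TensorSp m n) :
    (redDensity v * redDensity v).trace.re = ∑ j, ∑ k, ∑ l, ∑ l', purityTerm v j k l l' := by
  simp only [Matrix.trace, diag_apply, Matrix.mul_apply, redDensity, conjTranspose_apply,
    coeffMatrix, of_apply, Finset.sum_mul_sum, Complex.re_sum, purityTerm]

theorem sphereAvg_purityTerm_le (hm : 0 < m) (hn : 2 ≤ n) (j k : Fin m) (l l' : Fin n) :
    sphereAvg (fun v : TensorSp m n => purityTerm v j k l l') ≤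
      ((if j = k then 1 else 0) + (if l = l' then 1 else 0) +
        (if j = k then if l = l' then 1 else 0 else 0)) * (1 / (m * n : ℝ) ^ 2) := by
  have hn' : 0 < n := by lia
  have hsq : ∀ z w : ℂ, (z * star z * (w * star w)).re = ‖z‖ ^ 2 * ‖w‖ ^ 2 := fun z w => by
    simp only [Complex.star_def, Complex.mul_conj']
    exact_mod_cast Complex.ofReal_re _
  by_cases hjk : j = k
  · subst hjk
    have e : ∀ v : TensorSp m n, purityTerm v j j l l' = ‖v (j, l)‖ ^ 2 * ‖v (j, l')‖ ^ 2 :=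
      fun v => hsq _ _
    simp only [e]
    by_cases hl : l = l'
    · subst hl
      have : Nontrivial (Fin n) := Fin.nontrivial_iff_two_le.2 hn
      obtain ⟨l₂, hl₂⟩ := exists_ne l
      have h := sphereAvg_norm_pow_four_le hm hn' (a := (j, l)) (b := (j, l₂)) (by simp [hl₂.symm])
      simp only [← pow_add, if_true]
      refine h.trans (le_of_eq ?_)
      ring
    · simpa [hl] using sphereAvg_sq_mul_sq_le hm hn' (a := (j, l)) (b := (j, l')) (by simp [hl])
  · by_cases hl : l = l'
    · subst hl
      have e : ∀ v : TensorSp m n, purityTerm v j k l l = ‖v (j, l)‖ ^ 2 * ‖v (k, l)‖ ^ 2 :=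
        fun v => by rw [← hsq, purityTerm]; congr 1; ring
      simp only [e]
      simpa [hjk] using sphereAvg_sq_mul_sq_le hm hn' (a := (j, l)) (b := (k, l)) (by simp [hjk])
    · have h := sphereAvg_comp (flipIsometry (j, l)) (continuous_purityTerm j k l l')
      have e : ∀ v : TensorSp m n,
          purityTerm (flipIsometry (j, l) v) j k l l' = (-1) * purityTerm v j k l l' := fun v => by
        simp [purityTerm, flipIsometry_apply, Ne.symm hjk, Ne.symm hl]
      simp only [e] at h
      rw [sphereAvg_const_mul] at h
      simp only [hjk, hl, if_false, add_zero, zero_mul]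
      linarith

theorem sphereAvg_purity_le (hm : 0 < m) (hn : 2 ≤ n) :
    sphereAvg (fun v : TensorSp m n => (redDensity v * redDensity v).trace.re) ≤
      (m + n + 1) / (m * n) := by
  have hn' : 0 < n := by lia
  have hmr : (0 : ℝ) < m := by exact_mod_cast hm
  have hnr : (0 : ℝ) < n := by exact_mod_cast hn'
  have hc := fun (j k : Fin m) (l l' : Fin n) => continuous_purityTerm j k l l'
  calc sphereAvg (fun v : TensorSp m n => (redDensity v * redDensity v).trace.re)
      = ∑ j, ∑ k, ∑ l, ∑ l', sphereAvg (fun v : TensorSp m n => purityTerm v j k l l') := by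
        simp only [trace_redDensity_mul_self_re]
        rw [sphereAvg_sum hm hn' _ fun j => by fun_prop]
        refine Finset.sum_congr rfl fun j _ => ?_
        rw [sphereAvg_sum hm hn' _ fun k => by fun_prop]
        refine Finset.sum_congr rfl fun k _ => ?_
        rw [sphereAvg_sum hm hn' _ fun l => by fun_prop]
        exact Finset.sum_congr rfl fun l _ => sphereAvg_sum hm hn' _ fun l' => hc j k l l'
    _ ≤ ∑ j : Fin m, ∑ k : Fin m, ∑ l : Fin n, ∑ l' : Fin n,
        ((if j = k then 1 else 0) + (if l = l' then 1 else 0) +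
        (if j = k then if l = l' then 1 else 0 else 0)) * (1 / (m * n : ℝ) ^ 2) := by
        gcongr
        exact sphereAvg_purityTerm_le hm hn _ _ _ _
    _ = (m + n + 1) / (m * n) := by
        simp only [← Finset.sum_mul]
        have h : ∑ j : Fin m, ∑ k : Fin m, ∑ l : Fin n, ∑ l' : Fin n,
            (((if j = k then 1 else 0) + (if l = l' then 1 else 0) +
            (if j = k then if l = l' then 1 else 0 else 0)) : ℝ) = m * n * (m + n + 1) := by
          simp only [Finset.sum_add_distrib, Finset.sum_const, Finset.sum_ite_eq,
            Finset.sum_ite_irrel, Finset.mem_univ, if_true, Finset.card_univ, Fintype.card_fin,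
            nsmul_eq_mul, mul_one, mul_zero, mul_ite]
          ring
        rw [h]
        field_simp

theorem abs_avg_entEntropy_sub_log_le (hm : 0 < m) (hn : 2 ≤ n) :
    |(∫ v, entEntropy (v : TensorSp m n) ∂(sphereUniform m n)) - Real.log m| ≤ 2 * m / n := by
  have hn' : 0 < n := by lia
  have hmr : (1 : ℝ) ≤ m := by exact_mod_cast hm
  have hnr : (0 : ℝ) < n := by exact_mod_cast hn'
  have := isProbabilityMeasure_sphereUniform hm hn'
  have hnorm : ∀ v : Metric.sphere (0 : TensorSp m n) 1, ‖(v : TensorSp m n)‖ = 1 := by simp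
  have hint : Integrable (fun v : Metric.sphere (0 : TensorSp m n) 1 =>
      entEntropy (v : TensorSp m n)) (sphereUniform m n) := by
    refine Integrable.of_bound (measurable_entEntropy_sphere m n).aestronglyMeasurable (Real.log m)
      (Eventually.of_forall fun v => ?_)
    rw [Real.norm_eq_abs, abs_of_nonneg (entEntropy_nonneg (hnorm v))]
    exact entEntropy_le_log hm (hnorm v)
  have hcp : Continuous fun v : TensorSp m n => (redDensity v * redDensity v).trace.re :=
    Complex.continuous_re.comp
      ((continuous_redDensity m n).matrix_mul (continuous_redDensity m n)).matrix_trace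
  have hup : (∫ v, entEntropy (v : TensorSp m n) ∂(sphereUniform m n)) ≤ Real.log m := by
    have h := integral_mono hint (integrable_const (Real.log m))
      fun v => entEntropy_le_log hm (hnorm v)
    simpa using h
  have hlow := integral_mono ((integrable_const (Real.log m)).sub hint)
    (integrable_sphereUniform hm hn'
      (F := fun v => m * (redDensity v * redDensity v).trace.re + (-1)) (by fun_prop))
    fun v => by simpa [sub_eq_add_neg] using log_sub_entEntropy_le hm (hnorm v)
  simp only [Pi.sub_apply] at hlow
  rw [integral_sub (integrable_const _) hint] at hlow
  change _ ≤ sphereAvg (fun v : TensorSp m n =>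
    m * (redDensity v * redDensity v).trace.re + (-1)) at hlow
  rw [sphereAvg_add hm hn' (by fun_prop) (by fun_prop), sphereAvg_const hm hn',
    sphereAvg_const_mul] at hlow
  have h2 := mul_le_mul_of_nonneg_left (sphereAvg_purity_le hm hn) (by positivity : (0 : ℝ) ≤ m)
  have h3 : (m : ℝ) * ((m + n + 1) / (m * n)) = (m + 1) / n + 1 := by field_simp; ring
  have h4 : ((m : ℝ) + 1) / n ≤ 2 * m / n := by gcongr; linarith
  simp only [integral_const, probReal_univ, one_smul] at hlow
  rw [abs_sub_comm, abs_of_nonneg (by linarith)]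
  linarith

end Purity

section Asymptotics

theorem isBigO_ratio_sub_one {m : ℕ → ℕ} {c : ℝ} (hc : 0 < c) {d : ℕ} (hd : 1 ≤ d)
    (hm : (fun N : ℕ => (m N : ℝ) - c * (N : ℝ) ^ d) =O[atTop] fun N : ℕ => (N : ℝ) ^ (d - 1)) :
    (fun N : ℕ => (m N : ℝ) / (c * (N : ℝ) ^ d) - 1) =O[atTop] fun N : ℕ => 1 / (N : ℝ) := by
  have h := hm.mul (isBigO_refl (fun N : ℕ => 1 / (N : ℝ) ^ d) atTop)
  refine ((h.const_mul_left c⁻¹).congr' ?_ ?_)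
  · filter_upwards [eventually_gt_atTop 0] with N hN
    have : (0 : ℝ) < N := by exact_mod_cast hN
    field_simp
  · filter_upwards [eventually_gt_atTop 0] with N hN
    have : (0 : ℝ) < N := by exact_mod_cast hN
    obtain ⟨e, rfl⟩ := Nat.exists_eq_add_of_le' hd
    rw [Nat.add_sub_cancel, pow_succ]
    field_simp

theorem tendsto_ratio {m : ℕ → ℕ} {c : ℝ} (hc : 0 < c) {d : ℕ} (hd : 1 ≤ d)
    (hm : (fun N : ℕ => (m N : ℝ) - c * (N : ℝ) ^ d) =O[atTop] fun N : ℕ => (N : ℝ) ^ (d - 1)) :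
    Tendsto (fun N : ℕ => (m N : ℝ) / (c * (N : ℝ) ^ d)) atTop (nhds 1) :=
  tendsto_sub_nhds_zero_iff.1
    ((isBigO_ratio_sub_one hc hd hm).trans_tendsto tendsto_one_div_atTop_nhds_zero_nat)

theorem isBigO_log_sub {m : ℕ → ℕ} (hmpos : ∀ N, 0 < m N) {c : ℝ} (hc : 0 < c) {d : ℕ} (hd : 1 ≤ d)
    (hm : (fun N : ℕ => (m N : ℝ) - c * (N : ℝ) ^ d) =O[atTop] fun N : ℕ => (N : ℝ) ^ (d - 1)) :
    (fun N : ℕ => Real.log (m N) - (d * Real.log N + Real.log c))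
      =O[atTop] fun N : ℕ => 1 / (N : ℝ) := by
  have h := ((Real.hasDerivAt_log one_ne_zero).isBigO_sub.comp_tendsto
    (tendsto_ratio hc hd hm)).trans (isBigO_ratio_sub_one hc hd hm)
  refine h.congr' ?_ EventuallyEq.rfl
  filter_upwards [eventually_gt_atTop 0] with N hN
  have hN' : (0 : ℝ) < N := by exact_mod_cast hN
  have hm' : (0 : ℝ) < m N := by exact_mod_cast hmpos N
  simp only [Function.comp_apply, Real.log_one, sub_zero]
  rw [Real.log_div hm'.ne' (by positivity), Real.log_mul hc.ne' (by positivity), Real.log_pow]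
  ring

end Asymptotics

/-- Let `d₁ < d₂` be positive integers, `c₁, c₂ > 0`, and let
`m, n : ℕ → ℕ` be sequences of positive integers with
`m N = c₁ N^{d₁} + O(N^{d₁−1})` and `n N = c₂ N^{d₂} + O(N^{d₂−1})`.  Then the
average entanglement entropy of pure states in `ℂ^{m N} ⊗ ℂ^{n N}` satisfies
`⟨E_N⟩ = d₁ ln N + ln c₁ + O(1/N)` as `N → ∞`. -/
theorem average_entropy_asymptotics_different_dims
    (d₁ d₂ : ℕ) (hd₁ : 1 ≤ d₁) (hd : d₁ < d₂)
    (c₁ c₂ : ℝ) (hc₁ : 0 < c₁) (hc₂ : 0 < c₂)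
    (m n : ℕ → ℕ) (hmpos : ∀ N, 0 < m N) (hnpos : ∀ N, 0 < n N)
    (hm : (fun N : ℕ => (m N : ℝ) - c₁ * (N : ℝ) ^ d₁)
        =O[atTop] fun N : ℕ => (N : ℝ) ^ (d₁ - 1))
    (hn : (fun N : ℕ => (n N : ℝ) - c₂ * (N : ℝ) ^ d₂)
        =O[atTop] fun N : ℕ => (N : ℝ) ^ (d₂ - 1)) :
    (fun N : ℕ =>
        (∫ v, entEntropy (v : TensorSp (m N) (n N)) ∂(sphereUniform (m N) (n N))) -
          (d₁ * Real.log N + Real.log c₁))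
      =O[atTop] fun N : ℕ => 1 / (N : ℝ) := by
  have hd₂ : 1 ≤ d₂ := by lia
  have hmain : (fun N : ℕ =>
      (∫ v, entEntropy (v : TensorSp (m N) (n N)) ∂(sphereUniform (m N) (n N))) -
        Real.log (m N)) =O[atTop] fun N : ℕ => 1 / (N : ℝ) := by
    refine IsBigO.of_bound (8 * c₁ / c₂) ?_
    filter_upwards [(tendsto_ratio hc₁ hd₁ hm).eventually_le_const one_lt_two,
      (tendsto_ratio hc₂ hd₂ hn).eventually_const_le one_half_lt_one, eventually_gt_atTop 0,
      tendsto_natCast_atTop_atTop.eventually_ge_atTop (4 / c₂)] with N h1 h2 hN h4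
    have hN' : (1 : ℝ) ≤ N := by exact_mod_cast hN
    have hN0 : (0 : ℝ) < N := by linarith
    rw [div_le_iff₀ (by positivity)] at h1
    rw [le_div_iff₀ (by positivity)] at h2
    have hpow : (N : ℝ) * N ^ d₁ ≤ N ^ d₂ := by
      rw [← pow_succ']
      exact pow_le_pow_right₀ hN' hd
    have hn2 : 2 ≤ n N := by
      have h5 : (N : ℝ) ≤ N ^ d₂ := le_self_pow₀ hN' (by lia)
      rw [div_le_iff₀ hc₂] at h4
      have h6 : (2 : ℝ) ≤ n N := by nlinarith
      exact_mod_cast h6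
    have hn0 : (0 : ℝ) < n N := by exact_mod_cast hnpos N
    rw [Real.norm_eq_abs, Real.norm_of_nonneg (by positivity)]
    refine (abs_avg_entEntropy_sub_log_le (hmpos N) hn2).trans ?_
    rw [div_mul_div_comm, mul_one, div_le_div_iff₀ hn0 (by positivity)]
    calc 2 * (m N : ℝ) * (c₂ * N) ≤ 2 * (2 * (c₁ * N ^ d₁)) * (c₂ * N) := by gcongr
      _ = 8 * c₁ * (1 / 2 * (c₂ * (N * N ^ d₁))) := by ring
      _ ≤ 8 * c₁ * (1 / 2 * (c₂ * N ^ d₂)) := by gcongr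
      _ ≤ 8 * c₁ * n N := by gcongr
  refine (hmain.add (isBigO_log_sub hmpos hc₁ hd₁ hm)).congr_left fun N => ?_
  ring
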